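/- arXiv:2110.00744 — 4 statements merged into one kernel-verified Lean document; each statement's English description precedes it below -/
import Mathlib

section
/- Let M, N₀ be positive integers with N₀ ≤ M and let 0 < q < γ < 1. Let (A_e) be independent Bernoulli(q) random variables indexed by the unordered pairs e = {i,j} of distinct elements of Fin M. Then the probability that there exists a subset L ⊆ Fin M with |L| = N₀ such that the number of pairs e ⊆ L with A_e = 1 is at least γ·C(N₀,2) is at most C(M,N₀)·exp(−C(N₀,2)·d_KL(γ||q)), where C(a,b) denotes the binomial coefficient a choose b. -/
open Finset Classical

/-- The unordered pairs of distinct elements of `Fin M`, encoded as ordered pairs `(i,j)`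
with `i < j`. -/
abbrev Edge (M : ℕ) : Type := {e : Fin M × Fin M // e.1 < e.2}

/-- The Kullback–Leibler divergence between `Bernoulli(a)` and `Bernoulli(b)`. -/
noncomputable def klBern (a b : ℝ) : ℝ :=
  a * Real.log (a / b) + (1 - a) * Real.log ((1 - a) / (1 - b))

/-- The product Bernoulli weights with success probabilities `p` sum to `1`. -/
lemma sum_prod_bernoulli_weight {ι : Type*} [Fintype ι] [DecidableEq ι] (p : ι → ℝ) :
    ∑ ω : ι → Bool, ∏ e, (if ω e then p e else 1 - p e) = 1 := by
  have h := Finset.prod_univ_sum (fun _ : ι => (Finset.univ : Finset Bool))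
    (fun e b => if b then p e else 1 - p e)
  rw [Fintype.piFinset_univ] at h
  rw [← h]
  simp

/-- Tilting the success probability of the coordinates in `S` from `q` to `γ` loses at least the
factor `exp (-#S * klBern γ q)` on labelings with at least `γ * #S` successes in `S`. -/
lemma bernoulli_weight_le_exp_mul_tilted {ι : Type*} [Fintype ι] [DecidableEq ι] (S : Finset ι) {q γ : ℝ}
    (hq0 : 0 < q) (hqγ : q < γ) (hγ1 : γ < 1) (ω : ι → Bool)
    (hω : γ * (#S : ℝ) ≤ (#{e ∈ S | ω e = true} : ℝ)) :
    ∏ e, (if ω e then q else 1 - q) ≤ Real.exp (-((#S : ℝ) * klBern γ q)) *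
      ∏ e, (if ω e then (if e ∈ S then γ else q) else 1 - (if e ∈ S then γ else q)) := by
  have hγ0 : 0 < γ := hq0.trans hqγ
  have hγ1' : 0 < 1 - γ := sub_pos.2 hγ1
  have hq1' : 0 < 1 - q := by linarith
  set a := Real.log (γ / q) with ha
  set b := Real.log ((1 - γ) / (1 - q)) with hb
  have ha0 : 0 ≤ a := Real.log_nonneg ((one_le_div hq0).2 hqγ.le)
  have hb0 : b ≤ 0 := Real.log_nonpos (by positivity) ((div_le_one hq1').2 (by linarith))
  have hfactor : ∀ e, (if ω e then q else 1 - q) =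
      Real.exp (-(if e ∈ S then (if ω e then a else b) else 0)) *
        (if ω e then (if e ∈ S then γ else q) else 1 - (if e ∈ S then γ else q)) := by
    intro e
    by_cases he : e ∈ S <;> by_cases hωe : ω e = true <;> simp only [he, hωe, if_true, if_false,
      neg_zero, Real.exp_zero, one_mul, Bool.false_eq_true]
    · rw [ha, Real.exp_neg, Real.exp_log (by positivity)]
      field_simp
    · rw [hb, Real.exp_neg, Real.exp_log (by positivity)]
      field_simp
  have hsum : ∑ e, (if e ∈ S then (if ω e then a else b) else 0) =
      (#{e ∈ S | ω e = true} : ℝ) * a + ((#S : ℝ) - #{e ∈ S | ω e = true}) * b := by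
    have hcard : (#S : ℝ) = #{e ∈ S | ω e = true} + #{e ∈ S | ¬ ω e = true} := by
      exact_mod_cast (Finset.card_filter_add_card_filter_not (s := S) (fun e => ω e = true)).symm
    rw [← Finset.sum_filter, Finset.filter_univ_mem, Finset.sum_ite, Finset.sum_const,
      Finset.sum_const, nsmul_eq_mul, nsmul_eq_mul, hcard]
    ring
  rw [Finset.prod_congr rfl fun e _ => hfactor e, Finset.prod_mul_distrib, ← Real.exp_sum,
    Finset.sum_neg_distrib, hsum]
  gcongr
  · refine Finset.prod_nonneg fun e _ => ?_
    split_ifs <;> linarith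
  · rw [klBern, ← ha, ← hb]
    nlinarith [mul_nonneg (sub_nonneg.2 hω) (sub_nonneg.2 (hb0.trans ha0))]

/-- Chernoff bound for the number of successes in `S` under the product Bernoulli weight. -/
lemma sum_bernoulli_weight_tail_le {ι : Type*} [Fintype ι] [DecidableEq ι] (S : Finset ι) {q γ : ℝ}
    (hq0 : 0 < q) (hqγ : q < γ) (hγ1 : γ < 1) :
    (∑ ω : ι → Bool, if γ * (#S : ℝ) ≤ (#{e ∈ S | ω e = true} : ℝ)
      then ∏ e, (if ω e then q else 1 - q) else 0) ≤
      Real.exp (-((#S : ℝ) * klBern γ q)) := by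
  refine le_of_le_of_eq ?_ (mul_one _)
  refine le_of_le_of_eq ?_ (congrArg _
    (sum_prod_bernoulli_weight (fun e => if e ∈ S then γ else q)))
  rw [Finset.mul_sum]
  refine Finset.sum_le_sum fun ω _ => ?_
  split_ifs with hω
  · exact bernoulli_weight_le_exp_mul_tilted S hq0 hqγ hγ1 ω hω
  · refine mul_nonneg (Real.exp_nonneg _) (Finset.prod_nonneg fun e _ => ?_)
    split_ifs <;> linarith

/-- A set of `k` vertices spans `k.choose 2` edges. -/
lemma card_edges_within {M : ℕ} (L : Finset (Fin M)) :
    #{e : Edge M | e.val.1 ∈ L ∧ e.val.2 ∈ L} = (#L).choose 2 := by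
  rw [← Sym2.card_image_offDiag]
  refine Finset.card_nbij (fun e => s(e.val.1, e.val.2)) ?_ ?_ ?_
  · rintro ⟨⟨i, j⟩, hij⟩ he
    replace he : i ∈ L ∧ j ∈ L := by simpa using he
    exact Finset.mem_image.2 ⟨(i, j), Finset.mem_offDiag.2 ⟨he.1, he.2, hij.ne⟩, rfl⟩
  · rintro ⟨⟨i, j⟩, hij⟩ _ ⟨⟨k, l⟩, hkl⟩ _ h
    rcases Sym2.eq_iff.1 h with ⟨rfl, rfl⟩ | ⟨rfl, rfl⟩
    · rfl
    · exact absurd hij hkl.asymm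
  · intro z hz
    obtain ⟨⟨i, j⟩, hij, rfl⟩ := Finset.mem_image.1 (Finset.mem_coe.1 hz)
    obtain ⟨hi, hj, hne⟩ := Finset.mem_offDiag.1 hij
    rcases lt_or_gt_of_ne hne with h | h
    · exact ⟨⟨(i, j), h⟩, by simpa using ⟨hi, hj⟩, rfl⟩
    · exact ⟨⟨(j, i), h⟩, by simpa using ⟨hj, hi⟩, Sym2.eq_swap⟩

/-- Scan-test Type-I error bound (Chernoff form): for independent `Bernoulli(q)` edge labels
on the unordered pairs of `Fin M`, the probability that some `N₀`-element subset `L` contains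
at least `γ·C(N₀,2)` present edges is at most `C(M,N₀)·exp(−C(N₀,2)·d_KL(γ‖q))`.
The probability is written as the sum, over all edge labelings `ω`, of the product Bernoulli
weight of `ω` restricted to labelings realizing the event. -/
theorem scan_test_type_one_chernoff (M N₀ : ℕ) (hN₀ : 0 < N₀) (hNM : N₀ ≤ M)
    (q γ : ℝ) (hq0 : 0 < q) (hqγ : q < γ) (hγ1 : γ < 1) :
    (∑ ω : Edge M → Bool,
      if (∃ L ∈ Finset.powersetCard N₀ (Finset.univ : Finset (Fin M)),
            γ * (N₀.choose 2 : ℝ) ≤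
              ((Finset.univ.filter (fun e : Edge M =>
                  e.val.1 ∈ L ∧ e.val.2 ∈ L ∧ ω e = true)).card : ℝ))
      then ∏ e : Edge M, (if ω e then q else 1 - q)
      else 0)
      ≤ (M.choose N₀ : ℝ) * Real.exp (-((N₀.choose 2 : ℝ) * klBern γ q)) := by
  have hL : ∀ L ∈ Finset.powersetCard N₀ (Finset.univ : Finset (Fin M)),
      (∑ ω : Edge M → Bool, if γ * (N₀.choose 2 : ℝ) ≤
          (#{e : Edge M | e.val.1 ∈ L ∧ e.val.2 ∈ L ∧ ω e = true} : ℝ)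
        then ∏ e : Edge M, (if ω e then q else 1 - q) else 0) ≤
        Real.exp (-((N₀.choose 2 : ℝ) * klBern γ q)) := by
    intro L hL
    have h := sum_bernoulli_weight_tail_le
      ({e : Edge M | e.val.1 ∈ L ∧ e.val.2 ∈ L} : Finset (Edge M)) hq0 hqγ hγ1
    simpa only [card_edges_within, (Finset.mem_powersetCard.1 hL).2, Finset.filter_filter,
      and_assoc] using h
  have hw : ∀ ω : Edge M → Bool, 0 ≤ ∏ e : Edge M, (if ω e then q else 1 - q) := fun ω =>
    Finset.prod_nonneg fun e _ => by split_ifs <;> linarith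
  refine le_trans ?_ ((Finset.sum_le_sum hL).trans_eq ?_)
  · rw [Finset.sum_comm]
    refine Finset.sum_le_sum fun ω _ => ?_
    have hterm : ∀ L ∈ Finset.powersetCard N₀ (Finset.univ : Finset (Fin M)),
        0 ≤ if γ * (N₀.choose 2 : ℝ) ≤
            (#{e : Edge M | e.val.1 ∈ L ∧ e.val.2 ∈ L ∧ ω e = true} : ℝ)
          then ∏ e : Edge M, (if ω e then q else 1 - q) else 0 := fun L _ => by
      split_ifs
      exacts [hw ω, le_rfl]
    split_ifs with hex
    · obtain ⟨L, hLmem, hLω⟩ := hex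
      exact (if_pos hLω).symm.le.trans (Finset.single_le_sum hterm hLmem)
    · exact Finset.sum_nonneg hterm
  · simp
end

section
/- Let M, N₀ be positive integers with N₀ ≤ M, and let 0 < q < γ < p ≤ 1. Consider random edge labels on the unordered pairs of Fin M under two distributions: under H₀, all labels are independent Bernoulli(q); under H₁, a set K of N₀ vertices is chosen uniformly at random from Fin M, the labels of pairs inside K are independent Bernoulli(p), and all other labels are independent Bernoulli(q). Let φ be the scan test that outputs 1 if and only if there exists a subset L ⊆ Fin M with |L| = N₀ whose number of label-1 pairs inside L is at least γ·C(N₀,2). Then the risk P_{H₀}(φ = 1) + P_{H₁}(φ = 0) is at most C(M,N₀)·exp(−C(N₀,2)·d_KL(γ||q)) + exp(−(C(N₀,2)·p/2)·(1 − γ/p)²), where C(a,b) denotes the binomial coefficient a choose b. -/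
open Finset Classical

/-- The null distribution `H₀`: every edge label is an independent `Bernoulli(q)`. -/
noncomputable def nullProb (M : ℕ) (q : ℝ) (ω : Edge M → Bool) : ℝ :=
  ∏ e : Edge M, (if ω e then q else 1 - q)

/-- The planted distribution `H₁`: a set `K` of `N₀` vertices is chosen uniformly at random
from `Fin M`; labels of pairs inside `K` are independent `Bernoulli(p)` and all other labels
are independent `Bernoulli(q)`. -/
noncomputable def plantedProb (M N₀ : ℕ) (p q : ℝ) (ω : Edge M → Bool) : ℝ :=
  ((M.choose N₀ : ℝ))⁻¹ *
    ∑ K ∈ Finset.powersetCard N₀ (Finset.univ : Finset (Fin M)),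
      ∏ e : Edge M,
        (if e.val.1 ∈ K ∧ e.val.2 ∈ K then (if ω e then p else 1 - p)
         else (if ω e then q else 1 - q))

/-- The scan-test event: some `N₀`-element subset `L` of `Fin M` contains at least
`γ·C(N₀,2)` label-1 pairs. -/
def scanEvent (M N₀ : ℕ) (γ : ℝ) (ω : Edge M → Bool) : Prop :=
  ∃ L ∈ Finset.powersetCard N₀ (Finset.univ : Finset (Fin M)),
    γ * (N₀.choose 2 : ℝ) ≤
      ((Finset.univ.filter (fun e : Edge M =>
          e.val.1 ∈ L ∧ e.val.2 ∈ L ∧ ω e = true)).card : ℝ)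

/-- The edges inside a vertex set `L`. -/
def edgesIn {M : ℕ} (L : Finset (Fin M)) : Finset (Edge M) :=
  Finset.univ.filter fun e : Edge M => e.val.1 ∈ L ∧ e.val.2 ∈ L

theorem card_edgesIn {M : ℕ} (L : Finset (Fin M)) : (edgesIn L).card = L.card.choose 2 := by
  rw [← Finset.card_powersetCard]
  refine Finset.card_bij (fun e _ => {e.val.1, e.val.2}) ?_ ?_ ?_
  · rintro ⟨⟨a, b⟩, hab⟩ he
    simp only [edgesIn, Finset.mem_filter, Finset.mem_univ, true_and] at he
    rw [Finset.mem_powersetCard]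
    refine ⟨?_, Finset.card_pair (ne_of_lt hab)⟩
    simp [Finset.insert_subset_iff, he.1, he.2]
  · rintro ⟨⟨a, b⟩, hab⟩ _ ⟨⟨c, d⟩, hcd⟩ _ h
    simp only at hab hcd h
    have ha : a = c ∨ a = d := by
      have : a ∈ ({c, d} : Finset (Fin M)) := by rw [← h]; simp
      simpa using this
    have hb : b = c ∨ b = d := by
      have : b ∈ ({c, d} : Finset (Fin M)) := by rw [← h]; simp
      simpa using this
    have hac : a = c ∧ b = d := by grind
    simp [hac.1, hac.2]
  · intro s hs
    obtain ⟨hsL, hs2⟩ := Finset.mem_powersetCard.1 hs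
    obtain ⟨x, y, hxy, rfl⟩ := Finset.card_eq_two.1 hs2
    have hx : x ∈ L := hsL (by simp)
    have hy : y ∈ L := hsL (by simp)
    rcases lt_or_gt_of_ne hxy with h | h
    · exact ⟨⟨(x, y), h⟩, by simp [edgesIn, hx, hy], rfl⟩
    · exact ⟨⟨(y, x), h⟩, by simp [edgesIn, hx, hy], Finset.pair_comm y x⟩

/-- The moment generating function of the number of ones among the coordinates in `S`, for
independent Bernoulli coordinates with parameters `r`. -/
theorem sum_prod_bernoulli_mul_pow {E : Type*} [Fintype E] [DecidableEq E] (r : E → ℝ)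
    (S : Finset E) (x : ℝ) :
    ∑ ω : E → Bool, (∏ e, if ω e then r e else 1 - r e) *
        x ^ (S.filter fun e => ω e = true).card = ∏ e ∈ S, (1 - r e + r e * x) := by
  have key : ∀ ω : E → Bool, (∏ e, if ω e then r e else 1 - r e) *
      x ^ (S.filter fun e => ω e = true).card =
      ∏ e, ((if ω e then r e else 1 - r e) * if e ∈ S ∧ ω e = true then x else 1) := by
    intro ω
    rw [Finset.prod_mul_distrib]
    congr 1
    rw [Finset.prod_ite, Finset.prod_const, Finset.prod_const_one, mul_one]
    congr 2
    ext e
    simp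
  rw [Finset.sum_congr rfl fun ω _ => key ω, ← Fintype.prod_sum
    (fun e (b : Bool) => (if b then r e else 1 - r e) * if e ∈ S ∧ b = true then x else 1),
    ← Finset.prod_subset (Finset.subset_univ S)]
  · refine Finset.prod_congr rfl fun e he => ?_
    simp [he, add_comm]
  · intro e _ he
    simp [he]

/-- Chernoff's bound for independent Bernoulli coordinates. -/
theorem sum_bernoulli_event_le {E : Type*} [Fintype E] [DecidableEq E] (r : E → ℝ)
    (h0 : ∀ e, 0 ≤ r e) (h1 : ∀ e, r e ≤ 1) (S : Finset E) (s T : ℝ) (A : (E → Bool) → Prop)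
    [DecidablePred A]
    (hA : ∀ ω, A ω → 0 ≤ s * (((S.filter fun e => ω e = true).card : ℝ) - T)) :
    (∑ ω : E → Bool, if A ω then ∏ e, (if ω e then r e else 1 - r e) else 0) ≤
      Real.exp (-(s * T)) * ∏ e ∈ S, (1 - r e + r e * Real.exp s) := by
  rw [← sum_prod_bernoulli_mul_pow, Finset.mul_sum]
  refine Finset.sum_le_sum fun ω _ => ?_
  have hP : 0 ≤ ∏ e, (if ω e then r e else 1 - r e) := by
    refine Finset.prod_nonneg fun e _ => ?_
    split_ifs
    · exact h0 e
    · linarith [h1 e]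
  split_ifs with h
  · have h2 : 1 ≤ Real.exp (-(s * T)) * Real.exp s ^ (S.filter fun e => ω e = true).card := by
      rw [← Real.exp_nat_mul, ← Real.exp_add]
      refine Real.one_le_exp ?_
      linarith [hA ω h]
    nlinarith
  · positivity

theorem exp_neg_le_quadratic {t : ℝ} (ht : 0 ≤ t) : Real.exp (-t) ≤ 1 - t + t ^ 2 / 2 := by
  rw [Real.exp_neg, inv_le_comm₀ (Real.exp_pos t) (by nlinarith [sq_nonneg (t - 1)])]
  refine le_trans ?_ (Real.quadratic_le_exp_of_nonneg ht)
  rw [inv_le_iff_one_le_mul₀ (by nlinarith [sq_nonneg (t - 1)])]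
  nlinarith [sq_nonneg (t ^ 2)]

/-- The optimal Chernoff exponent for the upper tail of a Bernoulli variable is the
Kullback–Leibler divergence. -/
theorem exists_chernoff_eq_klBern {q γ : ℝ} (hq0 : 0 < q) (hqγ : q < γ) (hγ1 : γ < 1) :
    ∃ s, 0 ≤ s ∧ ∀ n : ℕ, Real.exp (-(s * (γ * n))) * (1 - q + q * Real.exp s) ^ n =
      Real.exp (-(n * klBern γ q)) := by
  have hγ0 : 0 < γ := hq0.trans hqγ
  have h1γ : 0 < 1 - γ := by linarith
  have h1q : 0 < 1 - q := by linarith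
  refine ⟨Real.log (γ * (1 - q) / (q * (1 - γ))), ?_, fun n => ?_⟩
  · refine Real.log_nonneg ?_
    rw [one_le_div (by positivity)]
    nlinarith
  · have hm : 1 - q + q * Real.exp (Real.log (γ * (1 - q) / (q * (1 - γ)))) =
        Real.exp (Real.log ((1 - q) / (1 - γ))) := by
      rw [Real.exp_log (by positivity), Real.exp_log (by positivity)]
      field_simp
      ring
    rw [hm, ← Real.exp_nat_mul, ← Real.exp_add]
    congr 1
    rw [klBern, Real.log_div (by positivity) (by positivity), Real.log_mul hγ0.ne' h1q.ne',
      Real.log_mul hq0.ne' h1γ.ne', Real.log_div h1q.ne' h1γ.ne', Real.log_div hγ0.ne' hq0.ne',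
      Real.log_div h1γ.ne' h1q.ne']
    ring

theorem filter_edgesIn {M : ℕ} (L : Finset (Fin M)) (ω : Edge M → Bool) :
    Finset.univ.filter (fun e : Edge M => e.val.1 ∈ L ∧ e.val.2 ∈ L ∧ ω e = true) =
      (edgesIn L).filter fun e => ω e = true := by
  ext e
  simp [edgesIn, and_assoc]

/-- Type-I error of the scan test. -/
theorem scan_typeI_le {M N₀ : ℕ} {q γ : ℝ} (hq0 : 0 < q) (hqγ : q < γ) (hγ1 : γ < 1) :
    (∑ ω : Edge M → Bool, if scanEvent M N₀ γ ω then nullProb M q ω else 0) ≤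
      (M.choose N₀ : ℝ) * Real.exp (-((N₀.choose 2 : ℝ) * klBern γ q)) := by
  obtain ⟨s, hs, hexp⟩ := exists_chernoff_eq_klBern hq0 hqγ hγ1
  let A (L : Finset (Fin M)) (ω : Edge M → Bool) : Prop :=
    γ * (N₀.choose 2 : ℝ) ≤ (((edgesIn L).filter fun e => ω e = true).card : ℝ)
  have hnn (ω : Edge M → Bool) : 0 ≤ nullProb M q ω := by
    refine Finset.prod_nonneg fun e _ => ?_
    split_ifs <;> linarith
  calc
    _ ≤ ∑ ω : Edge M → Bool, ∑ L ∈ Finset.powersetCard N₀ (Finset.univ : Finset (Fin M)),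
        if A L ω then nullProb M q ω else 0 := by
      refine Finset.sum_le_sum fun ω _ => ?_
      have hterm (L : Finset (Fin M)) : 0 ≤ if A L ω then nullProb M q ω else 0 := by
        split_ifs
        exacts [hnn ω, le_rfl]
      split_ifs with h
      · obtain ⟨L, hL, hLω⟩ := h
        rw [filter_edgesIn] at hLω
        refine le_trans ?_ (Finset.single_le_sum (fun L _ => hterm L) hL)
        rw [if_pos hLω]
      · exact Finset.sum_nonneg fun L _ => hterm L
    _ = ∑ L ∈ Finset.powersetCard N₀ (Finset.univ : Finset (Fin M)), ∑ ω : Edge M → Bool,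
        if A L ω then nullProb M q ω else 0 := Finset.sum_comm
    _ ≤ ∑ L ∈ Finset.powersetCard N₀ (Finset.univ : Finset (Fin M)),
        Real.exp (-((N₀.choose 2 : ℝ) * klBern γ q)) := by
      refine Finset.sum_le_sum fun L hL => ?_
      have hcard : (edgesIn L).card = N₀.choose 2 := by
        rw [card_edgesIn, (Finset.mem_powersetCard.1 hL).2]
      refine (sum_bernoulli_event_le (fun _ => q) (fun _ => hq0.le)
        (fun _ => (hqγ.trans hγ1).le) (edgesIn L) s (γ * (N₀.choose 2 : ℝ)) (A L)
        fun ω h => mul_nonneg hs (sub_nonneg.2 h)).trans_eq ?_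
      rw [Finset.prod_const, hcard, hexp]
    _ = _ := by
      rw [Finset.sum_const, Finset.card_powersetCard, Finset.card_univ, Fintype.card_fin,
        nsmul_eq_mul]

/-- Multiplicative Chernoff estimate for the lower tail. -/
theorem chernoff_lower_le {p γ : ℝ} (hp0 : 0 < p) (hp1 : p ≤ 1) (hγp : γ < p) (n : ℕ) :
    Real.exp (-(-(1 - γ / p) * (γ * n))) * (1 - p + p * Real.exp (-(1 - γ / p))) ^ n ≤
      Real.exp (-((n : ℝ) * p / 2) * (1 - γ / p) ^ 2) := by
  set t := 1 - γ / p with ht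
  have ht0 : 0 ≤ t := by
    rw [ht, sub_nonneg, div_le_one hp0]
    exact hγp.le
  have hγ : γ = p * (1 - t) := by
    rw [ht]
    field_simp
    ring
  have hb : 1 - p + p * Real.exp (-t) ≤ Real.exp (p * (-t + t ^ 2 / 2)) := by
    refine le_trans ?_ (Real.add_one_le_exp _)
    nlinarith [mul_le_mul_of_nonneg_left (exp_neg_le_quadratic ht0) hp0.le]
  have hb0 : 0 ≤ 1 - p + p * Real.exp (-t) :=
    add_nonneg (sub_nonneg.2 hp1) (mul_nonneg hp0.le (Real.exp_pos _).le)
  refine (mul_le_mul_of_nonneg_left (pow_le_pow_left₀ hb0 hb n) (Real.exp_pos _).le).trans_eq ?_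
  rw [← Real.exp_nat_mul, ← Real.exp_add]
  congr 1
  rw [hγ]
  ring

/-- Type-II error of the scan test. -/
theorem scan_typeII_le {M N₀ : ℕ} (hNM : N₀ ≤ M) {p q γ : ℝ} (hq0 : 0 < q) (hq1 : q ≤ 1)
    (hp0 : 0 < p) (hp1 : p ≤ 1) (hγp : γ < p) :
    (∑ ω : Edge M → Bool, if scanEvent M N₀ γ ω then 0 else plantedProb M N₀ p q ω) ≤
      Real.exp (-((N₀.choose 2 : ℝ) * p / 2) * (1 - γ / p) ^ 2) := by
  set B := Real.exp (-((N₀.choose 2 : ℝ) * p / 2) * (1 - γ / p) ^ 2) with hB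
  have ht0 : 0 ≤ 1 - γ / p := by
    rw [sub_nonneg, div_le_one hp0]
    exact hγp.le
  let r (K : Finset (Fin M)) (e : Edge M) : ℝ := if e.val.1 ∈ K ∧ e.val.2 ∈ K then p else q
  have hr (K : Finset (Fin M)) (ω : Edge M → Bool) :
      (∏ e : Edge M, (if e.val.1 ∈ K ∧ e.val.2 ∈ K then (if ω e then p else 1 - p)
        else (if ω e then q else 1 - q))) = ∏ e, if ω e then r K e else 1 - r K e := by
    refine Finset.prod_congr rfl fun e _ => ?_
    simp only [r]
    split_ifs <;> rfl
  have hK : ∀ K ∈ Finset.powersetCard N₀ (Finset.univ : Finset (Fin M)),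
      (∑ ω : Edge M → Bool, if ¬ scanEvent M N₀ γ ω then
        ∏ e, (if ω e then r K e else 1 - r K e) else 0) ≤ B := by
    intro K hK
    have hcard : (edgesIn K).card = N₀.choose 2 := by
      rw [card_edgesIn, (Finset.mem_powersetCard.1 hK).2]
    refine (sum_bernoulli_event_le (r K) ?_ ?_ (edgesIn K) (-(1 - γ / p))
      (γ * (N₀.choose 2 : ℝ)) (fun ω => ¬ scanEvent M N₀ γ ω) ?_).trans ?_
    · intro e
      simp only [r]
      split_ifs <;> linarith
    · intro e
      simp only [r]
      split_ifs <;> linarith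
    · intro ω hω
      refine mul_nonneg_of_nonpos_of_nonpos (neg_nonpos.2 ht0) (sub_nonpos.2 ?_)
      by_contra! hlt
      refine hω ⟨K, hK, ?_⟩
      rw [filter_edgesIn]
      exact hlt.le
    · have hprod : ∏ e ∈ edgesIn K, (1 - r K e + r K e * Real.exp (-(1 - γ / p))) =
          (1 - p + p * Real.exp (-(1 - γ / p))) ^ N₀.choose 2 := by
        rw [← hcard, ← Finset.prod_const]
        refine Finset.prod_congr rfl fun e he => ?_
        simp only [edgesIn, Finset.mem_filter, Finset.mem_univ, true_and] at he
        simp only [r, if_pos he]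
      rw [hprod]
      exact chernoff_lower_le hp0 hp1 hγp _
  have hc : (0 : ℝ) < M.choose N₀ := by exact_mod_cast Nat.choose_pos hNM
  calc
    _ = ((M.choose N₀ : ℝ))⁻¹ * ∑ K ∈ Finset.powersetCard N₀ (Finset.univ : Finset (Fin M)),
        ∑ ω : Edge M → Bool, if ¬ scanEvent M N₀ γ ω then
          ∏ e, (if ω e then r K e else 1 - r K e) else 0 := by
      rw [Finset.sum_comm, Finset.mul_sum]
      refine Finset.sum_congr rfl fun ω _ => ?_
      by_cases h : scanEvent M N₀ γ ω
      · simp [h]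
      · simp only [h, if_false, not_false_eq_true, if_true, plantedProb, hr]
    _ ≤ ((M.choose N₀ : ℝ))⁻¹ * ∑ K ∈ Finset.powersetCard N₀ (Finset.univ : Finset (Fin M)), B :=
      mul_le_mul_of_nonneg_left (Finset.sum_le_sum hK) (inv_nonneg.2 hc.le)
    _ = B := by
      rw [Finset.sum_const, Finset.card_powersetCard, Finset.card_univ, Fintype.card_fin,
        nsmul_eq_mul, inv_mul_cancel_left₀ hc.ne']

/-- Risk bound for the scan test: the sum of its Type-I and Type-II error probabilities is at
most `C(M,N₀)·exp(−C(N₀,2)·d_KL(γ‖q)) + exp(−(C(N₀,2)·p/2)·(1 − γ/p)²)`. -/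
theorem scan_test_risk (M N₀ : ℕ) (hN₀ : 0 < N₀) (hNM : N₀ ≤ M)
    (p q γ : ℝ) (hq0 : 0 < q) (hqγ : q < γ) (hγp : γ < p) (hp1 : p ≤ 1) :
    (∑ ω : Edge M → Bool, if scanEvent M N₀ γ ω then nullProb M q ω else 0) +
      (∑ ω : Edge M → Bool, if scanEvent M N₀ γ ω then 0 else plantedProb M N₀ p q ω)
      ≤ (M.choose N₀ : ℝ) * Real.exp (-((N₀.choose 2 : ℝ) * klBern γ q)) +
          Real.exp (-((N₀.choose 2 : ℝ) * p / 2) * (1 - γ / p) ^ 2) := by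
  exact add_le_add (scan_typeI_le hq0 hqγ (hγp.trans_le hp1))
    (scan_typeII_le hNM hq0 ((hqγ.trans hγp).le.trans hp1) (hq0.trans (hqγ.trans hγp)) hp1 hγp)
end

section
/- Let n, k, m be positive integers with k ≤ n and let δ ∈ (0,1). Let P and Q be probability measures on a measurable space with P absolutely continuous with respect to Q, with χ²(P,Q) = ∫ (dP/dQ)² dQ − 1 finite, and let C be a measurable nonnegative-integer-valued random variable whose law under Q is Binomial(m, p₀) for some p₀ ≤ k²/n². Then under P, with probability at least 1 − δ, C ≤ (m·k²/(δ·n²))·√(1 + n²/(m·k²))·√(1 + χ²(P,Q)). -/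
open MeasureTheory ENNReal

/-- The second moment of a binomial distribution. -/
lemma sum_sq_mul_binomial (m : ℕ) (p : ℝ) :
    ∑ i ∈ Finset.range (m + 1), (i : ℝ) ^ 2 * ((m.choose i : ℝ) * p ^ i * (1 - p) ^ (m - i)) =
      m * (m - 1) * p ^ 2 + m * p := by
  have h₁ := congrArg (Polynomial.eval p) (bernsteinPolynomial.sum_smul ℝ m)
  have h₂ := congrArg (Polynomial.eval p) (bernsteinPolynomial.sum_mul_smul ℝ m)
  have cast_mul_pred (j : ℕ) : ((j * (j - 1) : ℕ) : ℝ) = j * (j - 1) := by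
    cases j <;> simp
  simp only [bernsteinPolynomial, Polynomial.eval_finsetSum,
    nsmul_eq_mul, Polynomial.eval_mul, Polynomial.eval_natCast, Polynomial.eval_pow,
    Polynomial.eval_X, Polynomial.eval_sub, Polynomial.eval_one, cast_mul_pred] at h₁ h₂
  rw [← h₁, ← h₂, ← Finset.sum_add_distrib]
  exact Finset.sum_congr rfl fun i _ => by ring

/-- The second moment of a random variable with a binomial law. -/
lemma lintegral_sq_of_binomial_law {α : Type*} [MeasurableSpace α] {Q : Measure α} {m : ℕ}
    {p : ℝ} (hp₀ : 0 ≤ p) (hp₁ : p ≤ 1) {C : α → ℕ} (hC : Measurable C)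
    (hlaw : ∀ i : ℕ, Q {x | C x = i} =
      ENNReal.ofReal ((m.choose i : ℝ) * p ^ i * (1 - p) ^ (m - i))) :
    ∫⁻ x, (C x : ℝ≥0∞) ^ 2 ∂Q = ENNReal.ofReal (m * (m - 1) * p ^ 2 + m * p) := by
  have hterm (i : ℕ) : (i : ℝ≥0∞) ^ 2 * Q.map C {i} = ENNReal.ofReal
      ((i : ℝ) ^ 2 * ((m.choose i : ℝ) * p ^ i * (1 - p) ^ (m - i))) := by
    rw [Measure.map_apply hC (measurableSet_singleton i),
      ENNReal.ofReal_mul (by positivity), ENNReal.ofReal_pow (by positivity),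
      ENNReal.ofReal_natCast, ← hlaw i]
    rfl
  have h1p : 0 ≤ 1 - p := sub_nonneg.2 hp₁
  rw [← lintegral_map (f := fun i : ℕ => (i : ℝ≥0∞) ^ 2) (measurable_of_countable _) hC,
    lintegral_countable', tsum_congr hterm, tsum_eq_sum (s := Finset.range (m + 1)),
    ← ENNReal.ofReal_sum_of_nonneg fun i _ => by positivity, sum_sq_mul_binomial]
  intro i hi
  simp [Nat.choose_eq_zero_of_lt (show m < i by simpa using hi)]

/-- Change of measure by the Cauchy-Schwarz inequality. -/
lemma lintegral_le_rpow_lintegral_rnDeriv_sq {α : Type*} [MeasurableSpace α] {P Q : Measure α}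
    [SigmaFinite P] [SigmaFinite Q] (hPQ : P ≪ Q) {f : α → ℝ≥0∞} (hf : Measurable f) :
    ∫⁻ x, f x ∂P ≤
      (∫⁻ x, P.rnDeriv Q x ^ 2 ∂Q) ^ (1 / 2 : ℝ) * (∫⁻ x, f x ^ 2 ∂Q) ^ (1 / 2 : ℝ) := by
  rw [← lintegral_rnDeriv_mul hPQ hf.aemeasurable]
  simpa using ENNReal.lintegral_mul_le_Lp_mul_Lq Q Real.HolderConjugate.two_two
    (P.measurable_rnDeriv Q).aemeasurable hf.aemeasurable

/-- Markov's inequality as a lower bound on the probability of staying below the threshold. -/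
lemma ofReal_one_sub_le_measure_natCast_le {α : Type*} [MeasurableSpace α] {P : Measure α}
    [IsProbabilityMeasure P] {C : α → ℕ} (hC : Measurable C) {δ B : ℝ} (hδ : 0 ≤ δ) (hB : 0 < B)
    (h : ∫⁻ x, (C x : ℝ≥0∞) ∂P ≤ ENNReal.ofReal (δ * B)) :
    ENNReal.ofReal (1 - δ) ≤ P {x | (C x : ℝ) ≤ B} := by
  have hmeas : MeasurableSet {x | (C x : ℝ) ≤ B} :=
    measurableSet_le (measurable_from_nat.comp hC) measurable_const
  have htail : P {x | (C x : ℝ) ≤ B}ᶜ ≤ ENNReal.ofReal δ := by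
    have hsub : {x | (C x : ℝ) ≤ B}ᶜ ⊆ {x | ENNReal.ofReal B ≤ (C x : ℝ≥0∞)} := by
      intro x hx
      have hx : B < C x := not_le.1 hx
      simpa using ENNReal.ofReal_le_ofReal hx.le
    have hB' : ENNReal.ofReal B ≠ 0 := by simpa using hB
    refine (measure_mono hsub).trans ?_
    have hmarkov := mul_meas_ge_le_lintegral (μ := P)
      (f := fun x => (C x : ℝ≥0∞)) (measurable_from_nat.comp hC) (ENNReal.ofReal B)
    rw [mul_comm δ B, ENNReal.ofReal_mul hB.le] at h
    exact (ENNReal.mul_le_mul_iff_right hB' ENNReal.ofReal_ne_top).1 (hmarkov.trans h)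
  rw [ENNReal.ofReal_sub _ hδ, ENNReal.ofReal_one, tsub_le_iff_right,
    ← prob_add_prob_compl (μ := P) hmeas]
  gcongr

/-- Adaptive planted-edge-query bound: if `P ≪ Q` are probability measures with finite
chi-square distance `χ²(P,Q) = ∫ (dP/dQ)² dQ − 1`, and `C` is a random variable whose law
under `Q` is `Binomial(m, p₀)` with `p₀ ≤ k²/n²`, then under `P`, with probability at least
`1 − δ`, `C ≤ (m·k²/(δ·n²))·√(1 + n²/(m·k²))·√(1 + χ²(P,Q))`. -/
theorem adaptive_planted_queries_bound {α : Type*} [MeasurableSpace α]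
    (P Q : Measure α) [IsProbabilityMeasure P] [IsProbabilityMeasure Q] (hPQ : P ≪ Q)
    (n k m : ℕ) (hn : 0 < n) (hk : 0 < k) (hm : 0 < m) (hkn : k ≤ n)
    (δ : ℝ) (hδ0 : 0 < δ) (hδ1 : δ < 1)
    (p₀ : ℝ) (hp₀0 : 0 ≤ p₀) (hp₀ : p₀ ≤ (k : ℝ) ^ 2 / (n : ℝ) ^ 2)
    (C : α → ℕ) (hC : Measurable C)
    (hlaw : ∀ i : ℕ, Q {x | C x = i} =
      ENNReal.ofReal ((m.choose i : ℝ) * p₀ ^ i * (1 - p₀) ^ (m - i)))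
    (hchi : ∫⁻ x, P.rnDeriv Q x ^ 2 ∂Q ≠ ⊤) :
    ENNReal.ofReal (1 - δ) ≤
      P {x | (C x : ℝ) ≤
        ((m : ℝ) * (k : ℝ) ^ 2 / (δ * (n : ℝ) ^ 2)) *
          Real.sqrt (1 + (n : ℝ) ^ 2 / ((m : ℝ) * (k : ℝ) ^ 2)) *
          Real.sqrt (1 + ((∫⁻ x, P.rnDeriv Q x ^ 2 ∂Q).toReal - 1))} := by
  set L := ∫⁻ x, P.rnDeriv Q x ^ 2 ∂Q with hL
  have hp₁ : p₀ ≤ 1 := hp₀.trans (div_le_one_of_le₀ (by gcongr) (by positivity))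
  have hL0 : 0 < L.toReal := by
    refine ENNReal.toReal_pos (fun h0 => ?_) hchi
    have hone := lintegral_le_rpow_lintegral_rnDeriv_sq hPQ (f := fun _ => 1) measurable_const
    simp [← hL, h0] at hone
  set t : ℝ := m * (k : ℝ) ^ 2 / (n : ℝ) ^ 2 with ht
  have ht0 : 0 < t := by positivity
  have hmp : m * p₀ ≤ t := by
    rw [ht, mul_div_assoc]
    gcongr
  have hsecond : m * (m - 1) * p₀ ^ 2 + m * p₀ ≤ t ^ 2 + t := by
    have : (m * p₀) ^ 2 ≤ t ^ 2 := by gcongr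
    nlinarith [mul_nonneg m.cast_nonneg (sq_nonneg p₀)]
  have hsqrt : √(t ^ 2 + t) = t * √(1 + (n : ℝ) ^ 2 / (m * (k : ℝ) ^ 2)) := by
    rw [show (n : ℝ) ^ 2 / (m * (k : ℝ) ^ 2) = t⁻¹ by rw [ht, inv_div],
      show t ^ 2 + t = t ^ 2 * (1 + t⁻¹) by field_simp, Real.sqrt_mul (by positivity),
      Real.sqrt_sq ht0.le]
  have hmean : ∫⁻ x, (C x : ℝ≥0∞) ∂P ≤ ENNReal.ofReal (√(t ^ 2 + t) * √L.toReal) := by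
    refine (lintegral_le_rpow_lintegral_rnDeriv_sq hPQ (measurable_from_nat.comp hC)).trans ?_
    have hsq := (lintegral_sq_of_binomial_law hp₀0 hp₁ hC hlaw).trans_le
      (ENNReal.ofReal_le_ofReal hsecond)
    rw [mul_comm √(t ^ 2 + t), ENNReal.ofReal_mul (by positivity), Real.sqrt_eq_rpow,
      Real.sqrt_eq_rpow, ← ENNReal.ofReal_rpow_of_pos hL0,
      ← ENNReal.ofReal_rpow_of_pos (by positivity), ENNReal.ofReal_toReal hchi]
    gcongr
    exact hsq
  rw [add_sub_cancel]
  refine ofReal_one_sub_le_measure_natCast_le hC hδ0.le (by positivity) (hmean.trans_eq ?_)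
  rw [hsqrt, ht]
  congr 1
  field_simp
end

section
/- Let n, k be positive integers with k ≤ n, let I be a finite index set, let 0 ≤ p ≤ 1 and 0 < q < 1, and for each k-element subset K of Fin n let W_K ⊆ I. Define two probability distributions on functions x : I → {0,1}: under P₀ the coordinates are independent Bernoulli(q); under P₁ a k-element subset K of Fin n is chosen uniformly at random and, given K, the coordinates in W_K are independent Bernoulli(p) while the coordinates outside W_K are independent Bernoulli(q). Then χ²(P₁,P₀) + 1 = E[(1 + χ²(p||q))^{|W_{K₁} ∩ W_{K₂}|}], where K₁ and K₂ are independent uniformly random k-element subsets of Fin n, χ²(p||q) = (p−q)²/(q(1−q)) is the Bernoulli chi-square distance, and χ²(P₁,P₀) = Σ_x P₁(x)²/P₀(x) − 1 is the chi-square distance between the two distributions. -/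
open Finset Classical

/-- The sum over a Boolean coordinate of the product of two Bernoulli mass functions, each with
parameter `p` or `q`, relative to `Bernoulli(q)`. -/
theorem sum_bool_bernoulli_mul_div {p q : ℝ} (hq0 : 0 < q) (hq1 : q < 1) (a b : Prop)
    [Decidable a] [Decidable b] :
    ∑ x : Bool,
      (if a then (if x then p else 1 - p) else (if x then q else 1 - q)) *
        (if b then (if x then p else 1 - p) else (if x then q else 1 - q)) /
          (if x then q else 1 - q)
      = if a ∧ b then 1 + (p - q) ^ 2 / (q * (1 - q)) else 1 := by
  have hq : q ≠ 0 := hq0.ne'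
  have hq' : 1 - q ≠ 0 := (sub_pos.2 hq1).ne'
  by_cases ha : a <;> by_cases hb : b <;> simp [ha, hb] <;> field_simp <;> ring

/-- The likelihood-ratio inner product of two planted product distributions with planted sets
`A` and `B`. -/
theorem sum_planted_mul_div {I : Type*} [Fintype I] [DecidableEq I] {p q : ℝ}
    (hq0 : 0 < q) (hq1 : q < 1) (A B : Finset I) :
    ∑ ω : I → Bool,
      (∏ i : I, (if i ∈ A then (if ω i then p else 1 - p) else (if ω i then q else 1 - q))) *
        (∏ i : I, (if i ∈ B then (if ω i then p else 1 - p) else (if ω i then q else 1 - q))) /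
          (∏ i : I, (if ω i then q else 1 - q))
      = (1 + (p - q) ^ 2 / (q * (1 - q))) ^ (A ∩ B).card := by
  simp_rw [← Finset.prod_mul_distrib, ← Finset.prod_div_distrib]
  rw [← Fintype.prod_sum (fun (i : I) (x : Bool) =>
      (if i ∈ A then (if x then p else 1 - p) else (if x then q else 1 - q)) *
        (if i ∈ B then (if x then p else 1 - p) else (if x then q else 1 - q)) /
          (if x then q else 1 - q))]
  simp_rw [sum_bool_bernoulli_mul_div hq0 hq1, ← Finset.mem_inter]
  rw [Finset.prod_ite_mem, Finset.univ_inter, Finset.prod_const]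

/-- Chi-square identity for the planted query model: with `P₀` the product `Bernoulli(q)`
distribution on `x : I → Bool` and `P₁` the mixture, over a uniformly random `k`-element
subset `K` of `Fin n`, of the distribution with independent `Bernoulli(p)` coordinates on
`W K` and `Bernoulli(q)` coordinates elsewhere, one has
`χ²(P₁,P₀) + 1 = Σ_x P₁(x)²/P₀(x) = E[(1 + χ²(p‖q))^{|W K₁ ∩ W K₂|}]`, where `K₁, K₂` are
independent uniform `k`-subsets and `χ²(p‖q) = (p−q)²/(q(1−q))`. -/
theorem chi_square_identity {I : Type*} [Fintype I] [DecidableEq I]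
    (n k : ℕ) (hk : 0 < k) (hkn : k ≤ n)
    (p q : ℝ) (hp0 : 0 ≤ p) (hp1 : p ≤ 1) (hq0 : 0 < q) (hq1 : q < 1)
    (W : Finset (Fin n) → Finset I) :
    (∑ ω : I → Bool,
      (((n.choose k : ℝ))⁻¹ *
          ∑ K ∈ Finset.powersetCard k (Finset.univ : Finset (Fin n)),
            ∏ i : I,
              (if i ∈ W K then (if ω i then p else 1 - p)
               else (if ω i then q else 1 - q))) ^ 2 /
        (∏ i : I, (if ω i then q else 1 - q)))
    = ((n.choose k : ℝ))⁻¹ ^ 2 *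
        ∑ K₁ ∈ Finset.powersetCard k (Finset.univ : Finset (Fin n)),
          ∑ K₂ ∈ Finset.powersetCard k (Finset.univ : Finset (Fin n)),
            (1 + (p - q) ^ 2 / (q * (1 - q))) ^ ((W K₁ ∩ W K₂).card) := by
  simp_rw [← sum_planted_mul_div hq0 hq1, mul_pow, mul_div_assoc, ← Finset.mul_sum]
  congr 1
  simp_rw [sq, Finset.sum_mul_sum, Finset.sum_div]
  rw [Finset.sum_comm]
  refine Finset.sum_congr rfl fun K₁ _ => ?_
  rw [Finset.sum_comm]
  simp_rw [mul_div_assoc]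
end
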